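/- arXiv:1901.09554 — 2 statements merged into one kernel-verified Lean document; each statement's English description precedes it below -/
import Mathlib

section
/- Let τ, N, Ns be positive integers and let A_1,…,A_{Ns}, B_1,…,B_{Ns} ∈ ℂ^{τ×N} satisfy the OSTBC conditions. Then for every h ∈ ℂ^N, every s ∈ ℂ^{Ns}, and every index n, Re(h^H A_n^H X(s) h) = ‖h‖²·Re(s_n), where X(s) is the code matrix. -/
open Matrix Complex

/-- The OSTBC code matrix `X(s) = Σ_k (A_k · Re(s_k) + i · B_k · Im(s_k))`. -/
noncomputable def codeMatrix {τ N Ns : ℕ} (A B : Fin Ns → Matrix (Fin τ) (Fin N) ℂ)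
    (s : Fin Ns → ℂ) : Matrix (Fin τ) (Fin N) ℂ :=
  ∑ k, ((((s k).re : ℂ)) • A k + (Complex.I * ((s k).im : ℂ)) • B k)

/-- Conjugating a quadratic form conjugate-transposes its matrix. -/
theorem star_dotProduct_mulVec_conjTranspose {R ι : Type*} [CommRing R] [StarRing R] [Fintype ι]
    (M : Matrix ι ι R) (h : ι → R) :
    star h ⬝ᵥ (Mᴴ *ᵥ h) = star (star h ⬝ᵥ (M *ᵥ h)) := by
  rw [star_dotProduct, star_mulVec, conjTranspose_conjTranspose, dotProduct_mulVec]

/-- The quadratic form of a skew-Hermitian matrix is purely imaginary. -/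
theorem re_star_dotProduct_mulVec_eq_zero {ι : Type*} [Fintype ι] {M : Matrix ι ι ℂ}
    (hM : M + Mᴴ = 0) (h : ι → ℂ) : (star h ⬝ᵥ (M *ᵥ h)).re = 0 := by
  have key : (star h ⬝ᵥ ((M + Mᴴ) *ᵥ h)).re = 0 := by simp [hM]
  rw [add_mulVec, dotProduct_add, star_dotProduct_mulVec_conjTranspose, add_re,
    Complex.star_def, conj_re] at key
  linarith

/-- The quadratic form of a Hermitian matrix is real. -/
theorem im_star_dotProduct_mulVec_eq_zero {ι : Type*} [Fintype ι] {M : Matrix ι ι ℂ}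
    (hM : M.IsHermitian) (h : ι → ℂ) : (star h ⬝ᵥ (M *ᵥ h)).im = 0 := by
  have key := star_dotProduct_mulVec_conjTranspose M h
  rw [hM.eq] at key
  exact conj_eq_iff_im.mp key.symm

theorem re_star_dotProduct_self {ι : Type*} [Fintype ι] (h : ι → ℂ) :
    (star h ⬝ᵥ h).re = ∑ i, Complex.normSq (h i) := by
  simp [dotProduct, normSq_apply]

/-- under the OSTBC conditions, for every `h`, `s` and index `n`,
`Re(hᴴ A_nᴴ X(s) h) = ‖h‖² · Re(s_n)`. -/
theorem ostbc_decoupling_re {τ N Ns : ℕ} (hτ : 0 < τ) (hN : 0 < N) (hNs : 0 < Ns)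
    (A B : Fin Ns → Matrix (Fin τ) (Fin N) ℂ)
    (hA : ∀ k, (A k)ᴴ * A k = 1) (hB : ∀ k, (B k)ᴴ * B k = 1)
    (hAA : ∀ k l, k ≠ l → (A k)ᴴ * A l + (A l)ᴴ * A k = 0)
    (hBB : ∀ k l, k ≠ l → (B k)ᴴ * B l + (B l)ᴴ * B k = 0)
    (hAB : ∀ k l, (A k)ᴴ * B l = (B l)ᴴ * A k) :
    ∀ (h : Fin N → ℂ) (s : Fin Ns → ℂ) (n : Fin Ns),
      (star h ⬝ᵥ (((A n)ᴴ * codeMatrix A B s) *ᵥ h)).re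
        = (∑ i, Complex.normSq (h i)) * (s n).re := by
  intro h s n
  have hcross : ∀ k, (star h ⬝ᵥ (((A n)ᴴ * B k) *ᵥ h)).im = 0 := fun k =>
    im_star_dotProduct_mulVec_eq_zero
      (by rw [IsHermitian, conjTranspose_mul, conjTranspose_conjTranspose, hAB]) h
  have hterm : ∀ k, (star h ⬝ᵥ (((A n)ᴴ *
      ((((s k).re : ℂ)) • A k + (Complex.I * ((s k).im : ℂ)) • B k)) *ᵥ h)).re
        = (s k).re * (star h ⬝ᵥ (((A n)ᴴ * A k) *ᵥ h)).re := by
    intro k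
    rw [Matrix.mul_add, Matrix.mul_smul, Matrix.mul_smul, add_mulVec, smul_mulVec, smul_mulVec,
      dotProduct_add, dotProduct_smul, dotProduct_smul]
    simp [hcross k]
  rw [codeMatrix, Matrix.mul_sum, sum_mulVec, dotProduct_sum, re_sum,
    Finset.sum_congr rfl fun k _ => hterm k, Finset.sum_eq_single n]
  · rw [hA, one_mulVec, re_star_dotProduct_self, mul_comm]
  · intro k _ hk
    rw [re_star_dotProduct_mulVec_eq_zero _ h, mul_zero]
    rw [conjTranspose_mul, conjTranspose_conjTranspose, hAA n k hk.symm]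
  · simp
end

section
/- (Perfect-CSI versus imperfect-CSI power equivalence.) Let ρ, β̄, τ_p > 0 and define ρ' = ρ·((1+τ_p)/(2·τ_p) + √((1+τ_p)²/(4·τ_p²) + 1/(ρ·β̄·τ_p))). Then (1 + ρ'·β̄·(1+τ_p)) / (ρ'²·τ_p·β̄²) = 1/(ρ·β̄); that is, the imperfect-CSI SNR rate parameter λ^LS evaluated at transmit power ρ' (with p_p = p_d = ρ' and E_s = 1) equals the perfect-CSI rate parameter λ^P = 1/(ρ·β̄) at transmit power ρ. -/
/-- perfect- versus imperfect-CSI power equivalence: with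
`ρ' = ρ·((1+τ_p)/(2τ_p) + √((1+τ_p)²/(4τ_p²) + 1/(ρβ̄τ_p)))`, the imperfect-CSI rate
parameter at power `ρ'` equals the perfect-CSI rate parameter `1/(ρβ̄)` at power `ρ`. -/
theorem csi_power_equivalence (ρ βbar τp : ℝ)
    (hρ : 0 < ρ) (hβ : 0 < βbar) (hτp : 0 < τp)
    (ρ' : ℝ)
    (hρ' : ρ' = ρ * ((1 + τp) / (2 * τp)
        + Real.sqrt ((1 + τp) ^ 2 / (4 * τp ^ 2) + 1 / (ρ * βbar * τp)))) :
    (1 + ρ' * βbar * (1 + τp)) / (ρ' ^ 2 * τp * βbar ^ 2) = 1 / (ρ * βbar) := by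
  set s := Real.sqrt ((1 + τp) ^ 2 / (4 * τp ^ 2) + 1 / (ρ * βbar * τp))
  have hs0 : 0 ≤ s := Real.sqrt_nonneg _
  have hsq : s ^ 2 = (1 + τp) ^ 2 / (4 * τp ^ 2) + 1 / (ρ * βbar * τp) :=
    Real.sq_sqrt (by positivity)
  have hpos : 0 < ρ' := by rw [hρ']; positivity
  have hquad : ρ' ^ 2 * τp * βbar = ρ * (1 + ρ' * βbar * (1 + τp)) := by
    have hexp : ρ' ^ 2 = ρ ^ 2 * (((1 + τp) / (2 * τp)) ^ 2
        + 2 * ((1 + τp) / (2 * τp)) * s + s ^ 2) := by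
      rw [hρ']; ring
    rw [hexp, hsq, hρ']
    field_simp
    ring
  rw [div_eq_div_iff (by positivity) (by positivity)]
  linear_combination -βbar * hquad
end
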